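/- Let X be a finite abstract simplicial complex of dimension d on n vertices with a complete skeleton. Then the spectral gap satisfies λ(X) = min Spec Δ, the minimal eigenvalue of the full Laplacian Δ = Δ+ + Δ− on all of Ω^{d-1}. -/

import Mathlib

open Finset

/-- A finite abstract simplicial complex on the vertex type `V`: a collection of finite
subsets of `V` (the cells), closed under taking subsets and containing the empty cell. -/
structure SComplex (V : Type) [Fintype V] [DecidableEq V] : Type where
  cells : Finset (Finset V)
  empty_mem : ∅ ∈ cells
  down_closed : ∀ s ∈ cells, ∀ t ⊆ s, t ∈ cells

namespace SComplex

variable {V : Type} [Fintype V] [DecidableEq V]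

/-- The cells of `X` with exactly `m` vertices, i.e. the `(m-1)`-dimensional cells `X^{m-1}`. -/
def cellsCard (X : SComplex V) (m : ℕ) : Finset (Finset V) :=
  X.cells.filter fun s => s.card = m

/-- `X` is `D`-dimensional: every cell has at most `D+1` vertices and some cell has
exactly `D+1` vertices. -/
def Dim (X : SComplex V) (D : ℕ) : Prop :=
  (∀ s ∈ X.cells, s.card ≤ D + 1) ∧ ∃ s ∈ X.cells, s.card = D + 1

/-- `X` (of dimension `D`) has a complete skeleton: every subset of `V` with at most `D`
elements is a cell. -/
def CompleteSkeleton (X : SComplex V) (D : ℕ) : Prop :=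
  ∀ s : Finset V, s.card ≤ D → s ∈ X.cells

/-- The set of vertices of an ordered tuple. -/
def tset {m : ℕ} (σ : Fin m → V) : Finset V := Finset.image σ Finset.univ

/-- An ordered tuple of vertices is an oriented cell when it is injective and its vertex
set is a cell of `X`. -/
def IsCell (X : SComplex V) {m : ℕ} (σ : Fin m → V) : Prop :=
  Function.Injective σ ∧ tset σ ∈ X.cells

instance (X : SComplex V) {m : ℕ} (σ : Fin m → V) : Decidable (X.IsCell σ) := by
  unfold IsCell; infer_instance

/-- `X.nbr v σ` : the vertex `v` does not belong to `σ` and together with `σ` spans a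
cell of `X`. -/
def nbr (X : SComplex V) {m : ℕ} (v : V) (σ : Fin m → V) : Prop :=
  v ∉ tset σ ∧ insert v (tset σ) ∈ X.cells

instance (X : SComplex V) {m : ℕ} (v : V) (σ : Fin m → V) : Decidable (X.nbr v σ) := by
  unfold nbr; infer_instance

/-- `f` is an `(m-1)`-form on `X`: a function on ordered tuples of `m` vertices which is
skew-symmetric with respect to permutations of the tuple, and is supported on the
oriented `(m-1)`-cells of `X`. -/
def IsForm (X : SComplex V) (m : ℕ) (f : (Fin m → V) → ℝ) : Prop :=
  (∀ (σ : Fin m → V) (π : Equiv.Perm (Fin m)),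
      f (σ ∘ π) = ((Equiv.Perm.sign π : ℤ) : ℝ) * f σ) ∧
  ∀ σ : Fin m → V, ¬ X.IsCell σ → f σ = 0

/-- The space `Ω^{m-1}(X)` of `(m-1)`-forms, as a submodule of the functions on tuples. -/
def formSub (X : SComplex V) (m : ℕ) : Submodule ℝ ((Fin m → V) → ℝ) where
  carrier := {f | X.IsForm m f}
  add_mem' := @fun f g hf hg => ⟨fun σ π => by
      simp only [Pi.add_apply, hf.1 σ π, hg.1 σ π]; ring,
    fun σ h => by simp only [Pi.add_apply, hf.2 σ h, hg.2 σ h, add_zero]⟩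
  zero_mem' := ⟨fun σ π => by simp, fun σ h => rfl⟩
  smul_mem' := @fun c f hf => ⟨fun σ π => by
      simp only [Pi.smul_apply, smul_eq_mul, hf.1 σ π]; ring,
    fun σ h => by simp only [Pi.smul_apply, hf.2 σ h, smul_eq_mul, mul_zero]⟩

/-- The inner product `⟨f,g⟩ = ∑_{σ ∈ X^{m-1}} f(σ) g(σ)` on `(m-1)`-forms, computed via
ordered tuples (each cell is counted `m!` times, once for each ordering of its vertices). -/
noncomputable def innerForm (m : ℕ) (f g : (Fin m → V) → ℝ) : ℝ :=
  ((m.factorial : ℝ))⁻¹ * ∑ σ : Fin m → V, f σ * g σ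

/-- The boundary operator `∂ : Ω^m → Ω^{m-1}`, `(∂f)(σ) = ∑_{v ∼ σ} f(vσ)`. -/
def bdry (X : SComplex V) (m : ℕ) (f : (Fin (m+1) → V) → ℝ) : (Fin m → V) → ℝ :=
  fun σ => ∑ v : V, if X.nbr v σ then f (Fin.cons v σ) else 0

/-- The coboundary operator `∂* : Ω^{m-1} → Ω^m`, `(∂*f)(σ) = ∑ i (-1)^i f(σ ∖ σᵢ)`,
supported on the oriented `m`-cells of `X`. -/
def cobdry (X : SComplex V) (m : ℕ) (f : (Fin m → V) → ℝ) : (Fin (m+1) → V) → ℝ :=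
  fun σ => if X.IsCell σ then ∑ i : Fin (m+1), (-1 : ℝ) ^ (i : ℕ) * f (σ ∘ i.succAbove) else 0

/-- The upper Laplacian `Δ⁺ = ∂ ∘ ∂*` on `(m-1)`-forms. -/
def upLap (X : SComplex V) (m : ℕ) (f : (Fin m → V) → ℝ) : (Fin m → V) → ℝ :=
  X.bdry m (X.cobdry m f)

/-- The lower Laplacian `Δ⁻ = ∂* ∘ ∂` on `m`-forms. -/
def lowLap (X : SComplex V) (m : ℕ) (f : (Fin (m+1) → V) → ℝ) : (Fin (m+1) → V) → ℝ :=
  X.cobdry m (X.bdry m f)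

/-- The boundary operator as a linear map. -/
def bdryL (X : SComplex V) (m : ℕ) : ((Fin (m+1) → V) → ℝ) →ₗ[ℝ] ((Fin m → V) → ℝ) where
  toFun := X.bdry m
  map_add' f g := by
    funext σ
    show (∑ v : V, if X.nbr v σ then (f + g) (Fin.cons v σ) else 0) =
      (∑ v : V, if X.nbr v σ then f (Fin.cons v σ) else 0) +
      (∑ v : V, if X.nbr v σ then g (Fin.cons v σ) else 0)
    rw [← Finset.sum_add_distrib]
    exact Finset.sum_congr rfl fun v _ => by by_cases h : X.nbr v σ <;> simp [h]
  map_smul' c f := by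
    funext σ
    show (∑ v : V, if X.nbr v σ then (c • f) (Fin.cons v σ) else 0) =
      c * (∑ v : V, if X.nbr v σ then f (Fin.cons v σ) else 0)
    rw [Finset.mul_sum]
    exact Finset.sum_congr rfl fun v _ => by by_cases h : X.nbr v σ <;> simp [h]

/-- The coboundary operator as a linear map. -/
def cobdryL (X : SComplex V) (m : ℕ) : ((Fin m → V) → ℝ) →ₗ[ℝ] ((Fin (m+1) → V) → ℝ) where
  toFun := X.cobdry m
  map_add' f g := by
    funext σ
    show X.cobdry m (f + g) σ = X.cobdry m f σ + X.cobdry m g σ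
    unfold cobdry
    by_cases h : X.IsCell σ
    · simp only [h, if_true, ← Finset.sum_add_distrib]
      exact Finset.sum_congr rfl fun i _ => by simp [Pi.add_apply]; ring
    · simp [h]
  map_smul' c f := by
    funext σ
    show X.cobdry m (c • f) σ = c * X.cobdry m f σ
    unfold cobdry
    by_cases h : X.IsCell σ
    · simp only [h, if_true, Finset.mul_sum]
      exact Finset.sum_congr rfl fun i _ => by simp [Pi.smul_apply]; ring
    · simp [h]

/-- The degree of a cell `s`: the number of cells with one more vertex containing `s`. -/
def degCell (X : SComplex V) (s : Finset V) : ℕ :=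
  (X.cells.filter fun t => s ⊆ t ∧ t.card = s.card + 1).card

/-- The maximal degree of an `(m-1)`-cell of `X`. -/
def maxDeg (X : SComplex V) (m : ℕ) : ℕ :=
  (X.cellsCard m).sup fun s => X.degCell s

/-- The spectrum of the upper Laplacian of a `(d+1)`-dimensional complex restricted to
the cycle space `Z = ker ∂` inside the space of forms on `d+1` vertices. -/
def specUpLapZ (X : SComplex V) (d : ℕ) : Set ℝ :=
  {μ | ∃ f : (Fin (d+1) → V) → ℝ,
    X.IsForm (d+1) f ∧ X.bdry d f = 0 ∧ f ≠ 0 ∧ X.upLap (d+1) f = μ • f}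

/-- The spectral gap `λ(X) = min Spec (Δ⁺|_Z)` of a `(d+1)`-dimensional complex. -/
noncomputable def spectralGap (X : SComplex V) (d : ℕ) : ℝ :=
  sInf (X.specUpLapZ d)

/-- `F(A 0, …, A (m-1))`: the set of cells with `m` vertices having exactly one vertex
in each `A i`. -/
def Fcells (X : SComplex V) {m : ℕ} (A : Fin m → Finset V) : Finset (Finset V) :=
  X.cells.filter fun s => s.card = m ∧ ∀ i, (s ∩ A i).card = 1

/-- The Cheeger constant of a `(d+1)`-dimensional complex: the minimum over all
partitions of the vertex set into `d+2` nonempty parts of `n·|F(A₀,…)|/∏|Aᵢ|`. -/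
noncomputable def cheeger (X : SComplex V) (d : ℕ) : ℝ :=
  sInf { r : ℝ | ∃ A : Fin (d+2) → Finset V,
    (∀ i, (A i).Nonempty) ∧ (∀ i j, i ≠ j → Disjoint (A i) (A j)) ∧
    Finset.univ.biUnion A = Finset.univ ∧
    r = (Fintype.card V : ℝ) * ((X.Fcells A).card : ℝ) / ∏ i, ((A i).card : ℝ) }

/-- The `m`-th reduced Betti number `β_m = dim H_m` of `X` over `ℝ`:
`dim (Ω^m ∩ ker ∂_m) - dim (∂_{m+1} Ω^{m+1})`. -/
noncomputable def betti (X : SComplex V) (m : ℕ) : ℕ :=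
  Module.finrank ℝ ↥(X.formSub (m+1) ⊓ LinearMap.ker (X.bdryL m)) -
  Module.finrank ℝ ↥(Submodule.map (X.bdryL (m+1)) (X.formSub (m+2)))

/-- The vertices of the link of `τ`. -/
def linkVerts (X : SComplex V) (τ : Finset V) : Finset V :=
  Finset.univ.filter fun v => v ∉ τ ∧ insert v τ ∈ X.cells

/-- The neighbours of `v` in the link graph of `τ`. -/
def linkNbrs (X : SComplex V) (τ : Finset V) (v : V) : Finset V :=
  Finset.univ.filter fun w => w ≠ v ∧ w ∉ τ ∧ v ∉ τ ∧ insert v (insert w τ) ∈ X.cells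

/-- The graph Laplacian of the link of `τ`. -/
def linkLap (X : SComplex V) (τ : Finset V) (g : V → ℝ) : V → ℝ :=
  fun v => ((X.linkNbrs τ v).card : ℝ) * g v - ∑ w ∈ X.linkNbrs τ v, g w

/-- The graph spectral gap of the link of `τ`: the minimal eigenvalue of its graph
Laplacian on functions on its vertices summing to zero. -/
noncomputable def linkGap (X : SComplex V) (τ : Finset V) : ℝ :=
  sInf {μ : ℝ | ∃ g : V → ℝ, (∀ v, v ∉ X.linkVerts τ → g v = 0) ∧
    (∑ v ∈ X.linkVerts τ, g v = 0) ∧ g ≠ 0 ∧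
    ∀ v ∈ X.linkVerts τ, X.linkLap τ g v = μ * g v}

/-- The graph Cheeger constant of the link of `τ`: the minimum over partitions
`B ⊔ C` of its vertex set of `|W|·|E(B,C)|/(|B|·|C|)`. -/
noncomputable def linkCheeger (X : SComplex V) (τ : Finset V) : ℝ :=
  sInf { r : ℝ | ∃ B C : Finset V, B.Nonempty ∧ C.Nonempty ∧ Disjoint B C ∧
    B ∪ C = X.linkVerts τ ∧
    r = ((X.linkVerts τ).card : ℝ) *
        (((B ×ˢ C).filter fun p => insert p.1 (insert p.2 τ) ∈ X.cells).card : ℝ) /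
        ((B.card : ℝ) * (C.card : ℝ)) }

/-- `deg_τ(s)`: the number of neighbours `s'` of the cell `s` which contain `τ` (two
distinct cells with the same number of vertices are neighbours when their union is a
cell of `X` with one more vertex). -/
def degTau (X : SComplex V) (τ s : Finset V) : ℕ :=
  (X.cells.filter fun s' => s'.card = s.card ∧ s' ≠ s ∧ τ ⊆ s' ∧
    (s ∪ s').card = s.card + 1 ∧ s ∪ s' ∈ X.cells).card

/-- The local upper Laplacian `Δ⁺_τ` associated to a cell `τ` with `d` vertices of a
`(d+1)`-dimensional complex, acting on forms on `d+1` vertices: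
`(Δ⁺_τ f)(σ) = deg_τ(σ) f(σ) - ∑_{σ' ∼ σ, τ ⊆ σ'} f(σ')` when `τ ⊆ σ`, and `0` else. -/
def localUpLap (X : SComplex V) (d : ℕ) (τ : Finset V) (f : (Fin (d+1) → V) → ℝ) :
    (Fin (d+1) → V) → ℝ :=
  fun σ => if τ ⊆ tset σ then
      (X.degTau τ (tset σ) : ℝ) * f σ -
        ∑ v : V, if X.nbr v σ then
          ∑ i : Fin (d+1), if σ i ∉ τ then
            (-1 : ℝ) ^ (i : ℕ) * f (Fin.cons v σ ∘ Fin.succAbove i.succ) else 0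
        else 0
    else 0

/-- The complement complex `X̄` of a `D`-dimensional complex `X` with complete skeleton:
it has the same cells of dimension `< D`, and its `D`-dimensional cells are exactly the
vertex sets of size `D+1` which are not cells of `X`. -/
def complComplex (X : SComplex V) (D : ℕ) (hX : X.CompleteSkeleton D) : SComplex V where
  cells := (X.cells.filter fun s => s.card ≤ D) ∪
    ((Finset.univ : Finset V).powersetCard (D+1)).filter fun s => s ∉ X.cells
  empty_mem := Finset.mem_union_left _ (Finset.mem_filter.mpr ⟨X.empty_mem, by simp⟩)
  down_closed := by
    intro s hs t ht
    rcases Finset.mem_union.mp hs with h | h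
    · rw [Finset.mem_filter] at h
      exact Finset.mem_union_left _ (Finset.mem_filter.mpr
        ⟨X.down_closed s h.1 t ht, le_trans (Finset.card_le_card ht) h.2⟩)
    · rw [Finset.mem_filter, Finset.mem_powersetCard] at h
      by_cases hts : t = s
      · subst hts
        exact Finset.mem_union_right _ (Finset.mem_filter.mpr
          ⟨Finset.mem_powersetCard.mpr h.1, h.2⟩)
      · have hlt : t.card < s.card := Finset.card_lt_card (ht.ssubset_of_ne hts)
        have hsD : s.card = D + 1 := h.1.2
        have htD : t.card ≤ D := by omega
        exact Finset.mem_union_left _ (Finset.mem_filter.mpr ⟨hX t htD, htD⟩)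

/-- The simplicial complex on `V` with complete `(d+1)`-dimensional skeleton whose
top-dimensional cells (with `d+2` vertices) are the members of `T`: the Linial–Meshulam
complex determined by the sample `T`. -/
def lmComplex (V : Type) [Fintype V] [DecidableEq V] (d : ℕ) (T : Finset (Finset V)) :
    SComplex V where
  cells := (Finset.univ.powerset.filter fun s : Finset V => s.card ≤ d + 1) ∪
    T.filter fun s => s.card = d + 2
  empty_mem := Finset.mem_union_left _ (by simp)
  down_closed := by
    intro s hs t ht
    rcases Finset.mem_union.mp hs with h | h
    · rw [Finset.mem_filter] at h
      exact Finset.mem_union_left _ (Finset.mem_filter.mpr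
        ⟨Finset.mem_powerset.mpr (Finset.subset_univ t), le_trans (Finset.card_le_card ht) h.2⟩)
    · rw [Finset.mem_filter] at h
      by_cases hts : t = s
      · subst hts; exact Finset.mem_union_right _ (Finset.mem_filter.mpr h)
      · have hlt : t.card < s.card := Finset.card_lt_card (ht.ssubset_of_ne hts)
        have hsd : s.card = d + 2 := h.2
        have htd : t.card ≤ d + 1 := by omega
        exact Finset.mem_union_left _ (Finset.mem_filter.mpr
          ⟨Finset.mem_powerset.mpr (Finset.subset_univ t), htd⟩)

open Classical in
/-- The probability, under the Linial–Meshulam measure `X(d+1, n, p)` (each possible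
top-dimensional cell on `d+2` vertices is included independently with probability `p`),
of an event `E` depending on the set of top-dimensional cells. -/
noncomputable def lmProb (V : Type) [Fintype V] [DecidableEq V] (d : ℕ) (p : ℝ)
    (E : Finset (Finset V) → Prop) : ℝ :=
  ∑ T ∈ ((Finset.univ : Finset V).powersetCard (d+2)).powerset,
    if E T then
      p ^ T.card * (1 - p) ^ (((Finset.univ : Finset V).powersetCard (d+2)).card - T.card)
    else 0

end SComplex

namespace SComplex

section Skew

variable {V : Type} {m : ℕ}

/-- A function on ordered tuples that is skew-symmetric under permutations of the tuple. -/
def IsSkew (f : (Fin m → V) → ℝ) : Prop :=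
  ∀ (σ : Fin m → V) (π : Equiv.Perm (Fin m)),
    f (σ ∘ π) = ((Equiv.Perm.sign π : ℤ) : ℝ) * f σ

/-- The boundary operator of the full simplex. -/
def contract [Fintype V] (f : (Fin (m + 1) → V) → ℝ) (σ : Fin m → V) : ℝ :=
  ∑ v : V, f (Fin.cons v σ)

/-- The coboundary operator of the full simplex. -/
def delta (g : (Fin m → V) → ℝ) (σ : Fin (m + 1) → V) : ℝ :=
  ∑ i : Fin (m + 1), (-1 : ℝ) ^ (i : ℕ) * g (σ ∘ i.succAbove)

theorem IsSkew.eq_zero_of_not_injective {f : (Fin m → V) → ℝ} (hf : IsSkew f)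
    {σ : Fin m → V} (hσ : ¬ Function.Injective σ) : f σ = 0 := by
  simp only [Function.Injective, not_forall] at hσ
  obtain ⟨i, j, hij, hne⟩ := hσ
  have h := hf σ (Equiv.swap i j)
  have hs : σ ∘ Equiv.swap i j = σ := by
    rw [Equiv.comp_swap_eq_update, hij, Function.update_eq_self, ← hij, Function.update_eq_self]
  rw [hs, Equiv.Perm.sign_swap hne] at h
  push_cast at h
  linarith

/-- Extending a permutation by a fixed point at `0` keeps its sign. -/
theorem cons_comp_perm (v : V) (σ : Fin m → V) (π : Equiv.Perm (Fin m)) :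
    (Fin.cons v (σ ∘ π) : Fin (m + 1) → V) =
      (Fin.cons v σ : Fin (m + 1) → V) ∘ Equiv.Perm.decomposeFin.symm (0, π) := by
  funext i
  refine Fin.cases ?_ (fun j => ?_) i
  · simp
  · simp

theorem IsSkew.contract [Fintype V] {f : (Fin (m + 1) → V) → ℝ} (hf : IsSkew f) :
    IsSkew (contract f) := by
  intro σ π
  simp only [SComplex.contract, Finset.mul_sum]
  refine Finset.sum_congr rfl fun v _ => ?_
  rw [cons_comp_perm, hf]
  simp [Equiv.Perm.decomposeFin.symm_sign]

theorem contract_contract [Fintype V] {f : (Fin (m + 2) → V) → ℝ} (hf : IsSkew f) :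
    contract (contract f) = 0 := by
  funext σ
  have hswap : ∀ v w : V, f (Fin.cons v (Fin.cons w σ)) = - f (Fin.cons w (Fin.cons v σ)) := by
    intro v w
    have h := hf (Fin.cons w (Fin.cons v σ)) (Equiv.swap 0 1)
    rw [Equiv.Perm.sign_swap (by simp)] at h
    push_cast at h
    rw [neg_one_mul] at h
    rw [← h]
    congr 1
    funext i
    refine Fin.cases ?_ (fun j => Fin.cases ?_ (fun k => ?_) j) i
    · simp
    · simp
    · rw [Function.comp_apply, Equiv.swap_apply_of_ne_of_ne]
      · simp
      · exact Fin.succ_ne_zero _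
      · exact fun h => Fin.succ_ne_zero k (Fin.succ_injective _ h)
  have h : (∑ w : V, ∑ v : V, f (Fin.cons v (Fin.cons w σ))) =
      - ∑ w : V, ∑ v : V, f (Fin.cons v (Fin.cons w σ)) := by
    conv_rhs => rw [Finset.sum_comm]
    simp only [← Finset.sum_neg_distrib]
    exact Finset.sum_congr rfl fun w _ => Finset.sum_congr rfl fun v _ => hswap v w
  change (∑ w : V, ∑ v : V, f (Fin.cons v (Fin.cons w σ))) = 0
  linarith

/-- A permutation carrying `i` to `π i` restricts to a permutation of the complements, whose
sign differs by `(-1) ^ (i + π i)`. -/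
theorem exists_perm_comp_succAbove (π : Equiv.Perm (Fin (m + 1))) (i : Fin (m + 1)) :
    ∃ ρ : Equiv.Perm (Fin m), (π ∘ i.succAbove = (π i).succAbove ∘ ρ) ∧
      Equiv.Perm.sign ρ = (-1) ^ (i : ℕ) * (-1) ^ (π i : ℕ) * Equiv.Perm.sign π := by
  set τ : Equiv.Perm (Fin (m + 1)) := (π i).cycleRange * π * i.cycleRange⁻¹ with hτ
  obtain ⟨⟨p, ρ⟩, hρ⟩ := Equiv.Perm.decomposeFin.symm.surjective τ
  have hp : p = 0 := by
    have h0 : τ 0 = 0 := by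
      simp [hτ, Equiv.Perm.inv_def]
    rw [← hρ] at h0
    simpa using h0
  subst hp
  refine ⟨ρ, ?_, ?_⟩
  · funext j
    apply (π i).cycleRange.injective
    have h := congrArg (fun e : Equiv.Perm (Fin (m + 1)) => e j.succ) hρ
    simp only [hτ, Equiv.Perm.decomposeFin_symm_apply_succ, Equiv.swap_self, Equiv.refl_apply,
      Equiv.Perm.mul_apply, Equiv.Perm.inv_def, Fin.cycleRange_symm_succ] at h
    simp only [Function.comp_apply, Fin.cycleRange_succAbove]
    exact h.symm
  · have h := congrArg Equiv.Perm.sign hρ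
    rw [Equiv.Perm.decomposeFin.symm_sign, hτ] at h
    simp only [if_true, one_mul, map_mul, Equiv.Perm.sign_inv, Fin.sign_cycleRange] at h
    rw [h]
    rw [mul_right_comm, mul_comm ((-1 : ℤˣ) ^ (π i : ℕ))]

theorem IsSkew.delta {g : (Fin m → V) → ℝ} (hg : IsSkew g) : IsSkew (delta g) := by
  intro σ π
  simp only [SComplex.delta, Finset.mul_sum]
  rw [← Equiv.sum_comp π fun i => _ * ((-1 : ℝ) ^ (i : ℕ) * g (σ ∘ i.succAbove))]
  refine Finset.sum_congr rfl fun i _ => ?_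
  obtain ⟨ρ, h, hs⟩ := exists_perm_comp_succAbove π i
  rw [Function.comp_assoc, h, ← Function.comp_assoc, hg, hs]
  push_cast
  have h1 : ((-1 : ℝ) ^ (i : ℕ)) * (-1) ^ (i : ℕ) = 1 := by
    rw [← mul_pow]; simp
  linear_combination ((-1 : ℝ) ^ (π i : ℕ) * ((Equiv.Perm.sign π : ℤ) : ℝ) *
    g (σ ∘ (π i).succAbove)) * h1

/-- The operators `contract` and `delta` are adjoint, up to the factor `m + 1`. -/
theorem sum_mul_delta [Fintype V] {f : (Fin (m + 1) → V) → ℝ} (hf : IsSkew f)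
    (g : (Fin m → V) → ℝ) :
    ∑ τ, f τ * delta g τ = (m + 1) * ∑ σ, contract f σ * g σ := by
  have hi : ∀ i : Fin (m + 1), ∑ τ : Fin (m + 1) → V,
      f τ * ((-1 : ℝ) ^ (i : ℕ) * g (τ ∘ i.succAbove)) = ∑ σ, contract f σ * g σ := by
    intro i
    rw [← Equiv.sum_comp (Equiv.arrowCongr i.cycleRange.symm (Equiv.refl V)),
      ← Equiv.sum_comp (Fin.consEquiv fun _ => V), Fintype.sum_prod_type, Finset.sum_comm]
    refine Finset.sum_congr rfl fun σ _ => ?_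
    rw [contract, Finset.sum_mul]
    refine Finset.sum_congr rfl fun v _ => ?_
    have h1 : (Equiv.arrowCongr i.cycleRange.symm (Equiv.refl V))
        ((Fin.consEquiv fun _ => V) (v, σ)) = (Fin.cons v σ : Fin (m + 1) → V) ∘ i.cycleRange := by
      funext j; rfl
    have h2 : ((Fin.cons v σ : Fin (m + 1) → V) ∘ i.cycleRange) ∘ i.succAbove = σ := by
      funext j; simp
    have h3 : ((-1 : ℝ) ^ (i : ℕ)) * (-1) ^ (i : ℕ) = 1 := by
      rw [← mul_pow]; simp
    rw [h1, h2, hf, Fin.sign_cycleRange]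
    push_cast
    linear_combination (f (Fin.cons v σ) * g σ) * h3
  simp only [delta, Finset.mul_sum]
  rw [Finset.sum_comm]
  simp only [hi, ← Finset.mul_sum]
  simp

theorem contract_delta_zero [Fintype V] (f : (Fin 0 → V) → ℝ) :
    contract (delta f) = (Fintype.card V : ℝ) • f := by
  funext σ
  have h : ∀ τ : Fin 0 → V, τ = σ := fun τ => Subsingleton.elim _ _
  simp [contract, delta, h]

theorem contract_delta_succ [Fintype V] (f : (Fin (m + 1) → V) → ℝ) :
    contract (delta f) = (Fintype.card V : ℝ) • f - delta (contract f) := by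
  funext σ
  have h0 : ∀ v : V, (Fin.cons v σ : Fin (m + 2) → V) ∘ Fin.succ = σ := fun v => rfl
  have h1 : ∀ (v : V) (i : Fin (m + 1)), (Fin.cons v σ : Fin (m + 2) → V) ∘ i.succ.succAbove =
      Fin.cons v (σ ∘ i.succAbove) := by
    intro v i
    funext j
    refine Fin.cases ?_ (fun k => ?_) j <;> simp
  simp only [contract, delta, Fin.sum_univ_succ (n := m + 1), Finset.sum_add_distrib,
    Pi.sub_apply, Pi.smul_apply, smul_eq_mul, h1, Fin.succAbove_zero, h0, Fin.val_zero,
    pow_zero, one_mul, Finset.sum_const, Finset.card_univ, nsmul_eq_mul, sub_eq_add_neg]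
  rw [Finset.sum_comm, ← Finset.sum_neg_distrib]
  congr 1
  refine Finset.sum_congr rfl fun i _ => ?_
  rw [← Finset.mul_sum, Fin.val_succ, pow_succ]
  ring

theorem sum_mul_self_pos [Fintype V] {f : (Fin m → V) → ℝ} (hf : f ≠ 0) : 0 < ∑ σ, f σ * f σ := by
  obtain ⟨σ, hσ⟩ := Function.ne_iff.1 hf
  exact Finset.sum_pos' (fun τ _ => mul_self_nonneg _)
    ⟨σ, Finset.mem_univ _, mul_self_pos.2 hσ⟩

theorem delta_zero : delta (0 : (Fin m → V) → ℝ) = 0 := by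
  funext σ
  simp [delta]

theorem tset_cons [DecidableEq V] (v : V) (σ : Fin m → V) :
    tset (Fin.cons v σ : Fin (m + 1) → V) = insert v (tset σ) := by
  ext w
  simp [tset, Fin.exists_fin_succ, eq_comm]

theorem tset_comp_perm [DecidableEq V] (σ : Fin m → V) (π : Equiv.Perm (Fin m)) :
    tset (σ ∘ π) = tset σ := by
  ext w
  simp only [tset, Finset.mem_image, Finset.mem_univ, true_and, Function.comp_apply]
  exact (π.surjective.exists (p := fun a => σ a = w)).symm

end Skew

section Forms

variable {V : Type} [Fintype V] [DecidableEq V] (X : SComplex V) {m : ℕ}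

theorem IsForm.isSkew {X : SComplex V} {f : (Fin m → V) → ℝ} (hf : X.IsForm m f) : IsSkew f :=
  hf.1

theorem isCell_comp_perm (σ : Fin m → V) (π : Equiv.Perm (Fin m)) :
    X.IsCell (σ ∘ π) ↔ X.IsCell σ := by
  rw [IsCell, IsCell, tset_comp_perm, π.injective_comp]

theorem nbr_of_isCell_cons {v : V} {σ : Fin m → V}
    (h : X.IsCell (Fin.cons v σ : Fin (m + 1) → V)) : X.nbr v σ := by
  obtain ⟨hi, hc⟩ := h
  rw [Fin.cons_injective_iff] at hi
  refine ⟨?_, tset_cons v σ ▸ hc⟩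
  simpa [tset] using hi.1

theorem isCell_of_isCell_cons {v : V} {σ : Fin m → V}
    (h : X.IsCell (Fin.cons v σ : Fin (m + 1) → V)) : X.IsCell σ := by
  obtain ⟨hi, hc⟩ := h
  refine ⟨(Fin.cons_injective_iff.1 hi).2, X.down_closed _ hc _ ?_⟩
  rw [tset_cons]
  exact Finset.subset_insert _ _

theorem IsForm.bdry_eq {X : SComplex V} {f : (Fin (m + 1) → V) → ℝ} (hf : X.IsForm (m + 1) f) :
    X.bdry m f = contract f := by
  funext σ
  refine Finset.sum_congr rfl fun v _ => ?_
  split_ifs with h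
  · rfl
  · exact (hf.2 _ fun hc => h (X.nbr_of_isCell_cons hc)).symm

theorem IsForm.bdry {X : SComplex V} {f : (Fin (m + 1) → V) → ℝ} (hf : X.IsForm (m + 1) f) :
    X.IsForm m (X.bdry m f) := by
  rw [hf.bdry_eq]
  refine ⟨hf.isSkew.contract, fun σ hσ => Finset.sum_eq_zero fun v _ => ?_⟩
  exact hf.2 _ fun hc => hσ (X.isCell_of_isCell_cons hc)

theorem IsForm.bdry_bdry {X : SComplex V} {f : (Fin (m + 2) → V) → ℝ}
    (hf : X.IsForm (m + 2) f) : X.bdry m (X.bdry (m + 1) f) = 0 := by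
  rw [hf.bdry.bdry_eq, hf.bdry_eq, contract_contract hf.isSkew]

theorem cobdry_apply (f : (Fin m → V) → ℝ) (σ : Fin (m + 1) → V) :
    X.cobdry m f σ = if X.IsCell σ then delta f σ else 0 := rfl

theorem IsForm.cobdry {X : SComplex V} {f : (Fin m → V) → ℝ} (hf : X.IsForm m f) :
    X.IsForm (m + 1) (X.cobdry m f) := by
  refine ⟨fun σ π => ?_, fun σ hσ => by rw [cobdry_apply, if_neg hσ]⟩
  simp only [cobdry_apply, isCell_comp_perm]
  split_ifs
  · exact hf.isSkew.delta σ π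
  · simp

theorem CompleteSkeleton.isCell_iff {X : SComplex V} (hX : X.CompleteSkeleton m)
    {σ : Fin m → V} : X.IsCell σ ↔ Function.Injective σ :=
  ⟨fun h => h.1, fun h => ⟨h, hX _ (Finset.card_image_le.trans (by simp))⟩⟩

theorem CompleteSkeleton.cobdry_eq {X : SComplex V} (hX : X.CompleteSkeleton (m + 1))
    {f : (Fin m → V) → ℝ} (hf : IsSkew f) : X.cobdry m f = delta f := by
  funext σ
  simp only [cobdry_apply, hX.isCell_iff]
  split_ifs with h
  · rfl
  · exact (hf.delta.eq_zero_of_not_injective h).symm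

/-- In a complex with complete skeleton the lower Laplacian acts on coboundaries as
multiplication by the number of vertices. -/
theorem CompleteSkeleton.bdry_lowLap {X : SComplex V} (hX : X.CompleteSkeleton (m + 1))
    {f : (Fin (m + 1) → V) → ℝ} (hf : X.IsForm (m + 1) f) :
    X.bdry m (X.lowLap m f) = (Fintype.card V : ℝ) • X.bdry m f := by
  rw [lowLap, hf.bdry.cobdry.bdry_eq, hX.cobdry_eq hf.bdry.isSkew]
  cases m with
  | zero => exact contract_delta_zero _
  | succ k =>
    rw [contract_delta_succ, ← hf.bdry.bdry_eq, hf.bdry_bdry, delta_zero, sub_zero]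

theorem IsForm.upLap {X : SComplex V} {f : (Fin m → V) → ℝ} (hf : X.IsForm m f) :
    X.IsForm m (X.upLap m f) := hf.cobdry.bdry

theorem IsForm.sum_upLap_mul {X : SComplex V} {f : (Fin m → V) → ℝ} (hf : X.IsForm m f)
    (g : (Fin m → V) → ℝ) :
    (m + 1) * ∑ σ, X.upLap m f σ * g σ =
      ∑ τ : Fin (m + 1) → V, X.cobdry m f τ * X.cobdry m g τ := by
  rw [SComplex.upLap, hf.cobdry.bdry_eq, ← sum_mul_delta hf.cobdry.isSkew]
  refine Finset.sum_congr rfl fun τ _ => ?_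
  simp only [cobdry_apply]
  split_ifs <;> simp

/-- On cycles the upper Laplacian is bounded above by the number of vertices. -/
theorem IsForm.sum_upLap_mul_self_le {X : SComplex V} {f : (Fin (m + 1) → V) → ℝ}
    (hf : X.IsForm (m + 1) f) (hz : X.bdry m f = 0) :
    ∑ σ, X.upLap (m + 1) f σ * f σ ≤ Fintype.card V * ∑ σ, f σ * f σ := by
  have hd : contract (delta f) = (Fintype.card V : ℝ) • f := by
    rw [contract_delta_succ, ← hf.bdry_eq, hz, delta_zero, sub_zero]
  have h1 := sum_mul_delta hf.isSkew.delta f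
  have h2 := hf.sum_upLap_mul f
  have hle : ∑ τ : Fin (m + 2) → V, X.cobdry (m + 1) f τ * X.cobdry (m + 1) f τ ≤
      ∑ τ, delta f τ * delta f τ := by
    refine Finset.sum_le_sum fun τ _ => ?_
    rw [cobdry_apply]
    split_ifs
    · exact le_rfl
    · simpa using mul_self_nonneg _
  rw [h1, ← h2, hd] at hle
  have hpos : (0 : ℝ) < ((m + 1 : ℕ) : ℝ) + 1 := by positivity
  have h := le_of_mul_le_mul_left hle hpos
  simpa [Finset.mul_sum, mul_assoc] using h

theorem specUpLapZ_nonneg {d : ℕ} {μ : ℝ} (hμ : μ ∈ X.specUpLapZ d) : 0 ≤ μ := by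
  obtain ⟨f, hf, -, h0, he⟩ := hμ
  have h1 := hf.sum_upLap_mul f
  have h2 : 0 ≤ ∑ τ : Fin (d + 2) → V, X.cobdry (d + 1) f τ * X.cobdry (d + 1) f τ :=
    Finset.sum_nonneg fun τ _ => mul_self_nonneg _
  rw [← h1, he] at h2
  simp only [Pi.smul_apply, smul_eq_mul, mul_assoc, ← Finset.mul_sum] at h2
  have hpos : (0 : ℝ) < ((d + 1 : ℕ) : ℝ) + 1 := by positivity
  exact nonneg_of_mul_nonneg_left (nonneg_of_mul_nonneg_right h2 hpos) (sum_mul_self_pos h0)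

theorem specUpLapZ_le_card {d : ℕ} {μ : ℝ} (hμ : μ ∈ X.specUpLapZ d) : μ ≤ Fintype.card V := by
  obtain ⟨f, hf, hz, h0, he⟩ := hμ
  have h := hf.sum_upLap_mul_self_le hz
  rw [he] at h
  simp only [Pi.smul_apply, smul_eq_mul, mul_assoc, ← Finset.mul_sum] at h
  exact le_of_mul_le_mul_right h (sum_mul_self_pos h0)

/-- A top-dimensional cell has a nonzero boundary. -/
theorem exists_cycle_ne_zero {d : ℕ} {s : Finset V} (hs : s ∈ X.cells) (hc : s.card = d + 2) :
    ∃ f, X.IsForm (d + 1) f ∧ X.bdry d f = 0 ∧ f ≠ 0 := by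
  let e := s.equivFinOfCardEq hc
  let τ : Fin (d + 2) → V := fun i => (e.symm i : V)
  have hτ : Function.Injective τ := Subtype.val_injective.comp e.symm.injective
  have hts : tset τ = s := by
    ext w
    simp only [tset, Finset.mem_image, Finset.mem_univ, true_and]
    exact ⟨fun ⟨i, hi⟩ => hi ▸ (e.symm i).2, fun hw => ⟨e ⟨w, hw⟩, by simp [τ]⟩⟩
  let F : (Fin (d + 2) → V) → ℝ := fun σ =>
    ∑ π : Equiv.Perm (Fin (d + 2)), if σ = τ ∘ π then ((Equiv.Perm.sign π : ℤ) : ℝ) else 0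
  have hF : X.IsForm (d + 2) F := by
    refine ⟨fun σ π => ?_, fun σ hσ => Finset.sum_eq_zero fun π _ => if_neg ?_⟩
    · simp only [F, Finset.mul_sum]
      rw [← Equiv.sum_comp (Equiv.mulRight π)]
      refine Finset.sum_congr rfl fun ρ _ => ?_
      have h : (σ ∘ π = τ ∘ (ρ * π : Equiv.Perm (Fin (d + 2)))) ↔ σ = τ ∘ ρ := by
        rw [Equiv.Perm.coe_mul, ← Function.comp_assoc]
        exact π.surjective.injective_comp_right.eq_iff
      simp only [Equiv.coe_mulRight, h, map_mul]
      split_ifs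
      · push_cast; ring
      · simp
    · rintro rfl
      exact hσ ((X.isCell_comp_perm _ _).2 ⟨hτ, hts ▸ hs⟩)
  refine ⟨X.bdry (d + 1) F, hF.bdry, hF.bdry_bdry, fun h0 => ?_⟩
  have h := congrFun h0 (Fin.tail τ)
  have hfix : ∀ (v : V) (π : Equiv.Perm (Fin (d + 2))),
      (Fin.cons v (Fin.tail τ) : Fin (d + 2) → V) = τ ∘ π → v = τ 0 ∧ π = 1 := by
    intro v π hv
    have hsucc : ∀ i : Fin (d + 1), π i.succ = i.succ := fun i =>
      (hτ (by simpa [Fin.tail] using congrFun hv i.succ)).symm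
    have hzero : π 0 = 0 := by
      by_contra hne
      obtain ⟨j, hj⟩ := Fin.exists_succ_eq.2 hne
      exact Fin.succ_ne_zero j (π.injective ((hsucc j).trans hj))
    refine ⟨by simpa [hzero] using congrFun hv 0, ?_⟩
    ext i
    refine Fin.cases ?_ (fun j => ?_) i
    · simp [hzero]
    · simp [hsucc]
  have hval : contract F (Fin.tail τ) = 1 := by
    rw [contract, Finset.sum_eq_single (τ 0), Fin.cons_self_tail]
    · simp only [F]
      rw [Finset.sum_eq_single 1]
      · simp
      · intro π _ hπ
        refine if_neg fun h => hπ (hfix (τ 0) π ?_).2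
        rwa [Fin.cons_self_tail]
      · simp
    · intro v _ hv
      exact Finset.sum_eq_zero fun π _ => if_neg fun h => hv (hfix v π h).1
    · simp
  rw [hF.bdry_eq, hval] at h
  simp at h

/-- The upper Laplacian as a linear map. -/
def upLapL (m : ℕ) : ((Fin m → V) → ℝ) →ₗ[ℝ] ((Fin m → V) → ℝ) :=
  X.bdryL m ∘ₗ X.cobdryL m

theorem specUpLapZ_nonempty {d : ℕ}
    (hX : ∃ f, X.IsForm (d + 1) f ∧ X.bdry d f = 0 ∧ f ≠ 0) : (X.specUpLapZ d).Nonempty := by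
  let e := WithLp.linearEquiv 2 ℝ ((Fin (d + 1) → V) → ℝ)
  let Z : Submodule ℝ (EuclideanSpace ℝ (Fin (d + 1) → V)) :=
    (X.formSub (d + 1) ⊓ LinearMap.ker (X.bdryL d)).comap e.toLinearMap
  let T : EuclideanSpace ℝ (Fin (d + 1) → V) →ₗ[ℝ] EuclideanSpace ℝ (Fin (d + 1) → V) :=
    e.symm.toLinearMap ∘ₗ X.upLapL (d + 1) ∘ₗ e.toLinearMap
  have hZ : ∀ x, x ∈ Z ↔ X.IsForm (d + 1) (e x) ∧ X.bdry d (e x) = 0 := fun x => Iff.rfl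
  have hT : ∀ x, e (T x) = X.upLap (d + 1) (e x) := fun x => rfl
  have hTZ : ∀ x ∈ Z, T x ∈ Z := by
    intro x hx
    rw [hZ] at hx ⊢
    rw [hT]
    exact ⟨hx.1.upLap, hx.1.cobdry.bdry_bdry⟩
  have hinner : ∀ x y : EuclideanSpace ℝ (Fin (d + 1) → V),
      inner ℝ x y = ∑ σ, e x σ * e y σ := by
    intro x y
    rw [PiLp.inner_apply]
    exact Finset.sum_congr rfl fun σ _ => mul_comm _ _
  have hsymm : (T.restrict hTZ).IsSymmetric := by
    rintro ⟨x, hx⟩ ⟨y, hy⟩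
    change inner ℝ (T x) y = inner ℝ x (T y)
    rw [real_inner_comm (T y) x, hinner, hinner, hT, hT]
    have hpos : ((d + 1 : ℕ) : ℝ) + 1 ≠ 0 := by positivity
    apply mul_left_cancel₀ hpos
    rw [((hZ x).1 hx).1.sum_upLap_mul, ((hZ y).1 hy).1.sum_upLap_mul]
    exact Finset.sum_congr rfl fun σ _ => mul_comm _ _
  obtain ⟨f, hf, hz, h0⟩ := hX
  have : Nontrivial Z := by
    refine ⟨⟨⟨e.symm f, ⟨hf, hz⟩⟩, 0, fun h => h0 ?_⟩⟩
    exact (LinearEquiv.map_eq_zero_iff e.symm).1 (congrArg Subtype.val h)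
  obtain ⟨x, hx⟩ := hsymm.hasEigenvalue_iInf_of_finiteDimensional.exists_hasEigenvector
  refine ⟨⨅ y : { y : Z // y ≠ 0 },
    RCLike.re (inner ℝ (T.restrict hTZ y) (y : Z)) / ‖(y : Z)‖ ^ 2, e x, x.2.1, x.2.2,
    fun h => hx.2 (Subtype.ext ((LinearEquiv.map_eq_zero_iff e).1 h)), ?_⟩
  have h := congrArg (fun y : Z => e y) hx.apply_eq_smul
  exact h

end Forms

end SComplex

open SComplex in
/-- Proposition 3.3(1): for a `(d+1)`-dimensional complex with complete skeleton, the
spectral gap equals the minimal eigenvalue of the full Laplacian `Δ = Δ⁺ + Δ⁻` on the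
whole space of forms `Ω^{d}`. -/
theorem spectralGap_eq_min_fullLap (V : Type) [Fintype V] [DecidableEq V] (d : ℕ)
    (X : SComplex V) (hdim : X.Dim (d + 1)) (hskel : X.CompleteSkeleton (d + 1)) :
    X.spectralGap d =
      sInf {μ : ℝ | ∃ f : (Fin (d + 1) → V) → ℝ,
        X.IsForm (d + 1) f ∧ f ≠ 0 ∧ X.upLap (d + 1) f + X.lowLap d f = μ • f} := by
  have hsub : {μ : ℝ | ∃ f : (Fin (d + 1) → V) → ℝ,
      X.IsForm (d + 1) f ∧ f ≠ 0 ∧ X.upLap (d + 1) f + X.lowLap d f = μ • f} ⊆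
      insert (Fintype.card V : ℝ) (X.specUpLapZ d) := by
    rintro μ ⟨f, hf, h0, he⟩
    by_cases hz : X.bdry d f = 0
    · refine Or.inr ⟨f, hf, hz, h0, ?_⟩
      rw [← he, lowLap, hz]
      exact (add_zero (X.upLap (d + 1) f)).symm.trans
        (congrArg _ (X.cobdryL d).map_zero.symm)
    · refine Or.inl ?_
      have h := congrArg (X.bdryL d) he
      rw [map_add, map_smul] at h
      change X.bdry d (X.upLap (d + 1) f) + X.bdry d (X.lowLap d f) = μ • X.bdry d f at h
      rw [upLap, hf.cobdry.bdry_bdry, zero_add, hskel.bdry_lowLap hf] at h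
      exact (smul_left_injective ℝ hz h).symm
  have hsup : X.specUpLapZ d ⊆ {μ : ℝ | ∃ f : (Fin (d + 1) → V) → ℝ,
      X.IsForm (d + 1) f ∧ f ≠ 0 ∧ X.upLap (d + 1) f + X.lowLap d f = μ • f} := by
    rintro μ ⟨f, hf, hz, h0, he⟩
    refine ⟨f, hf, h0, ?_⟩
    rw [he, lowLap, hz]
    exact (congrArg _ (X.cobdryL d).map_zero).trans (add_zero _)
  obtain ⟨s, hs, hc⟩ := hdim.2
  obtain ⟨ν, hν⟩ := X.specUpLapZ_nonempty (X.exists_cycle_ne_zero hs hc)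
  have hbdd : BddBelow (X.specUpLapZ d) := ⟨0, fun μ hμ => X.specUpLapZ_nonneg hμ⟩
  refine le_antisymm (le_csInf ⟨ν, hsup hν⟩ fun μ hμ => ?_)
    (csInf_le_csInf ((hbdd.insert _).mono hsub) ⟨ν, hν⟩ hsup)
  rcases hsub hμ with rfl | h
  · exact (csInf_le hbdd hν).trans (X.specUpLapZ_le_card hν)
  · exact csInf_le hbdd h
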